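/- Consider a DMC W with finite input alphabet X containing the 'off' symbol 0 and finite output alphabet Y, with Q0 = W(·|0) and supp(Q0) = Y, and fix δ > 0. Then the limit lim_{n→∞} √(n/δ) · max_{P_n} I(P_n, W) exists (possibly equal to +∞) and equals L, where for each n the maximum is over input distributions P_n on X whose induced output distributions Q_n = P_n W satisfy D(Q_n ‖ Q0) ≤ δ/n. -/

import Mathlib

open Filter
open scoped BigOperators Topology

/-- `p` is a probability mass function on a finite type. -/
def IsDist {α : Type*} [Fintype α] (p : α → ℝ) : Prop :=
  (∀ a, 0 ≤ p a) ∧ ∑ a, p a = 1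

/-- Relative entropy (in nats) between pmfs on a finite type. -/
noncomputable def relEnt {α : Type*} [Fintype α] (p q : α → ℝ) : ℝ :=
  ∑ a, p a * Real.log (p a / q a)

/-- Output distribution on `Y` induced by input distribution `P` through channel `W`. -/
noncomputable def outDist {X Y : Type*} [Fintype X] (P : X → ℝ) (W : X → Y → ℝ) : Y → ℝ :=
  fun y => ∑ x, P x * W x y

/-- Mutual information `I(P, W)`. -/
noncomputable def mutInfo {X Y : Type*} [Fintype X] [Fintype Y] (P : X → ℝ) (W : X → Y → ℝ) : ℝ :=
  ∑ x, ∑ y, P x * W x y * Real.log (W x y / outDist P W y)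

/-- The output distribution on `Y^n` induced by a random code (a distribution `ρ` over
encoder/decoder pairs) together with a uniformly chosen message, through `n` memoryless
uses of the channel `W`. -/
noncomputable def codeOut {X Y : Type*} [Fintype X] [Fintype Y] [DecidableEq Y]
    (W : X → Y → ℝ) {n m : ℕ}
    (ρ : (Fin m → Fin n → X) × ((Fin n → Y) → Fin m) → ℝ) : (Fin n → Y) → ℝ :=
  fun ys => ∑ c, ρ c * ((m : ℝ)⁻¹ * ∑ j, ∏ i, W (c.1 j i) (ys i))

/-- Average probability of a decoding error of a random code, the message being uniform. -/
noncomputable def codeErr {X Y : Type*} [Fintype X] [Fintype Y] [DecidableEq Y]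
    (W : X → Y → ℝ) {n m : ℕ}
    (ρ : (Fin m → Fin n → X) × ((Fin n → Y) → Fin m) → ℝ) : ℝ :=
  ∑ c, ρ c * ((m : ℝ)⁻¹ * ∑ j, ∑ ys : Fin n → Y,
    if c.2 ys = j then 0 else ∏ i, W (c.1 j i) (ys i))

/-- `Kmax W x0 δ ε n` is the maximum of `log |M|` (in nats) over random codes of
blocklength `n` whose induced output distribution `Q^n` satisfies
`D(Q^n ‖ Q0^{×n}) ≤ δ` (with `Q0 = W(·|x0)`) and whose average error probability
is at most `ε`. -/
noncomputable def Kmax {X Y : Type*} [Fintype X] [Fintype Y] [DecidableEq Y]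
    (W : X → Y → ℝ) (x0 : X) (δ ε : ℝ) (n : ℕ) : ℝ :=
  sSup {k : ℝ | ∃ m : ℕ, 0 < m ∧
    ∃ ρ : (Fin m → Fin n → X) × ((Fin n → Y) → Fin m) → ℝ,
      (∀ c, 0 ≤ ρ c) ∧ (∑ c, ρ c) = 1 ∧
      relEnt (codeOut W ρ) (fun ys : Fin n → Y => ∏ i, W x0 (ys i)) ≤ δ ∧
      codeErr W ρ ≤ ε ∧ k = Real.log m}

/-- `IsL W x0 δ L` says that `L = lim_{ε↓0} liminf_{n→∞} K_n(δ,ε)/√(nδ)`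
(as an extended real, so that `L = ⊤` is allowed). -/
noncomputable def IsL {X Y : Type*} [Fintype X] [Fintype Y] [DecidableEq Y]
    (W : X → Y → ℝ) (x0 : X) (δ : ℝ) (L : EReal) : Prop :=
  Tendsto (fun ε : ℝ =>
      liminf (fun n : ℕ => ((Kmax W x0 δ ε n / Real.sqrt (n * δ) : ℝ) : EReal)) atTop)
    (nhdsWithin 0 (Set.Ioi 0)) (nhds L)



/-!
STATEMENT 3: For any DMC (with `supp(Q0) = Y`) and `δ > 0`, the limit
`lim_{n→∞} √(n/δ) · max_{P_n} I(P_n,W)` exists (possibly `+∞`) and equals `L`, the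
per-`n` maximum being over input distributions whose induced output distributions
satisfy `D(P_n W ‖ Q0) ≤ δ/n`.
-/

/-! ### Marginals of product weights -/

section ProductWeights

variable {ι α : Type*} [Fintype ι] [DecidableEq ι] [Fintype α]

theorem sum_prod_pi (h : ι → α → ℝ) : ∑ f : ι → α, ∏ i, h i (f i) = ∏ i, ∑ a, h i a := by
  rw [Finset.prod_univ_sum, Fintype.piFinset_univ]

theorem sum_prod_pi_eq_one {p : ι → α → ℝ} (hp : ∀ i, ∑ a, p i a = 1) :
    ∑ f : ι → α, ∏ i, p i (f i) = 1 := by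
  simp [sum_prod_pi, hp]

theorem sum_prod_pi_mul_pair {p : ι → α → ℝ} (hp : ∀ i, ∑ a, p i a = 1) {j k : ι} (hjk : j ≠ k)
    (A B : α → ℝ) :
    ∑ f : ι → α, (∏ i, p i (f i)) * (A (f j) * B (f k))
      = (∑ a, p j a * A a) * ∑ a, p k a * B a := by
  have h1 : ∀ f : ι → α, (∏ i, p i (f i)) * (A (f j) * B (f k))
      = ∏ i, p i (f i) * ((if i = j then A (f i) else 1) * (if i = k then B (f i) else 1)) := by
    intro f
    rw [Finset.prod_mul_distrib, Finset.prod_mul_distrib]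
    simp
  simp_rw [h1]
  rw [sum_prod_pi fun i a => p i a * ((if i = j then A a else 1) * (if i = k then B a else 1))]
  rw [← Finset.mul_prod_erase _ _ (Finset.mem_univ j),
    ← Finset.mul_prod_erase _ _ (Finset.mem_erase.2 ⟨hjk.symm, Finset.mem_univ k⟩),
    Finset.prod_eq_one]
  · simp [hjk, hjk.symm]
  · intro i hi
    simp only [Finset.mem_erase, Finset.mem_univ, and_true] at hi
    simp [hi.1, hi.2, hp]

theorem sum_prod_pi_mul {p : ι → α → ℝ} (hp : ∀ i, ∑ a, p i a = 1) (j : ι) (A : α → ℝ) :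
    ∑ f : ι → α, (∏ i, p i (f i)) * A (f j) = ∑ a, p j a * A a := by
  have h1 : ∀ f : ι → α, (∏ i, p i (f i)) * A (f j)
      = ∏ i, p i (f i) * (if i = j then A (f i) else 1) := by
    intro f
    rw [Finset.prod_mul_distrib]
    simp
  simp_rw [h1]
  rw [sum_prod_pi fun i a => p i a * (if i = j then A a else 1),
    ← Finset.mul_prod_erase _ _ (Finset.mem_univ j), Finset.prod_eq_one]
  · simp
  · intro i hi
    simp only [Finset.mem_erase, Finset.mem_univ, and_true] at hi
    simp [hi, hp]

theorem sum_prod_pi_mul_sq_sum {p : α → ℝ} (hp : ∑ a, p a = 1) {ξ : α → ℝ}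
    (hξ : ∑ a, p a * ξ a = 0) :
    ∑ f : ι → α, (∏ i, p (f i)) * (∑ i, ξ (f i)) ^ 2
      = Fintype.card ι * ∑ a, p a * ξ a ^ 2 := by
  simp_rw [sq, Finset.sum_mul_sum, Finset.mul_sum (s := Finset.univ (α := ι))]
  rw [Finset.sum_comm]
  have h : ∀ j : ι, ∑ f : ι → α, ∑ k, (∏ i, p (f i)) * (ξ (f j) * ξ (f k))
      = ∑ a, p a * (ξ a * ξ a) := by
    intro j
    rw [Finset.sum_comm, Finset.sum_eq_single j]
    · exact sum_prod_pi_mul (p := fun _ => p) (fun _ => hp) j fun a => ξ a * ξ a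
    · intro k _ hk
      rw [sum_prod_pi_mul_pair (p := fun _ => p) (fun _ => hp) hk.symm ξ ξ, hξ, zero_mul]
    · simp
  simp [h]

/-- Chebyshev's inequality for the lower tail of a sum of i.i.d. variables. -/
theorem chebyshev_lower_tail {p : α → ℝ} (hp : IsDist p) (ξ : α → ℝ) {a : ℝ} (ha : 0 < a) :
    ∑ f : ι → α, (∏ i, p (f i)) *
        (if ∑ i, ξ (f i) ≤ Fintype.card ι * (∑ z, p z * ξ z) - a then 1 else 0)
      ≤ Fintype.card ι * (∑ z, p z * ξ z ^ 2) / a ^ 2 := by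
  set μ := ∑ z, p z * ξ z with hμ
  have hc : ∑ z, p z * (ξ z - μ) = 0 := by
    simp_rw [mul_sub, Finset.sum_sub_distrib, ← Finset.sum_mul, hp.2, ← hμ]; ring
  have hv : ∑ z, p z * (ξ z - μ) ^ 2 ≤ ∑ z, p z * ξ z ^ 2 := by
    have : ∑ z, p z * (ξ z - μ) ^ 2 = ∑ z, p z * ξ z ^ 2 - μ ^ 2 := by
      have h1 : ∀ z, p z * (ξ z - μ) ^ 2 = p z * ξ z ^ 2 - 2 * μ * (p z * ξ z) + μ ^ 2 * p z := by
        intro z; ring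
      simp_rw [h1, Finset.sum_add_distrib, Finset.sum_sub_distrib, ← Finset.mul_sum, hp.2, ← hμ]
      ring
    rw [this]; nlinarith [sq_nonneg μ]
  calc _ ≤ ∑ f : ι → α, (∏ i, p (f i)) * ((∑ i, (ξ (f i) - μ)) ^ 2 / a ^ 2) := by
        refine Finset.sum_le_sum fun f _ => mul_le_mul_of_nonneg_left ?_
          (Finset.prod_nonneg fun i _ => hp.1 _)
        split_ifs with h
        · rw [one_le_div (by positivity)]
          have : ∑ i, (ξ (f i) - μ) ≤ -a := by
            simp only [Finset.sum_sub_distrib, Finset.sum_const, Finset.card_univ, nsmul_eq_mul]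
            linarith
          nlinarith
        · positivity
    _ = (Fintype.card ι * ∑ z, p z * (ξ z - μ) ^ 2) / a ^ 2 := by
        rw [← sum_prod_pi_mul_sq_sum hp.2 hc, Finset.sum_div]
        exact Finset.sum_congr rfl fun f _ => by ring
    _ ≤ _ := by gcongr

end ProductWeights

/-! ### Scalar inequalities -/

theorem sub_le_mul_log_div {p r : ℝ} (hp : 0 ≤ p) (hr : 0 ≤ r) (h : r = 0 → p = 0) :
    p - r ≤ p * Real.log (p / r) := by
  rcases hp.eq_or_lt with rfl | hp
  · simpa using hr
  have hr : 0 < r := hr.lt_of_ne fun h' => hp.ne' (h h'.symm)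
  have := Real.one_sub_inv_le_log_of_pos (div_pos hp hr)
  calc p - r = p * (1 - (p / r)⁻¹) := by field_simp
    _ ≤ _ := by gcongr

theorem sq_sqrt_sub_one_le {u : ℝ} (hu : 0 ≤ u) :
    (√u - 1) ^ 2 ≤ u * Real.log u - u + 1 := by
  rcases hu.eq_or_lt with rfl | hu
  · simp
  have hs : 0 < √u := Real.sqrt_pos.2 hu
  have h2 : √u * √u = u := Real.mul_self_sqrt hu.le
  have h1 : Real.log u = 2 * Real.log (√u) := by rw [Real.log_sqrt hu.le]; ring
  have h3 := Real.one_sub_inv_le_log_of_pos hs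
  have h4 : u * (2 * (1 - (√u)⁻¹)) ≤ u * Real.log u := by rw [h1]; gcongr
  have h5 : u * (√u)⁻¹ = √u := by rw [← div_eq_mul_inv, Real.div_sqrt]
  nlinarith

theorem sq_sub_one_le {u B : ℝ} (hu : 0 ≤ u) (hB : 1 ≤ B) (huB : u ≤ B) :
    (u - 1) ^ 2 ≤ 4 * B * (u * Real.log u - u + 1) := by
  have h2 : √u * √u = u := Real.mul_self_sqrt hu
  have h1 := sq_sqrt_sub_one_le hu
  have h3 : (√u + 1) ^ 2 ≤ 4 * B := by nlinarith [sq_nonneg (√u - 1), Real.sqrt_nonneg u]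
  calc (u - 1) ^ 2 = (√u + 1) ^ 2 * (√u - 1) ^ 2 := by nth_rewrite 1 [← h2]; ring
    _ ≤ _ := mul_le_mul h3 h1 (sq_nonneg _) (by linarith)

theorem mul_log_sq_le {u B : ℝ} (hu : 0 ≤ u) (hB : 1 ≤ B) (huB : u ≤ B) :
    u * Real.log u ^ 2 ≤ 4 * B * (u * Real.log u - u + 1) := by
  have h1 := sq_sqrt_sub_one_le hu
  suffices h : u * Real.log u ^ 2 ≤ 4 * B * (√u - 1) ^ 2 from
    h.trans (mul_le_mul_of_nonneg_left h1 (by linarith))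
  rcases hu.eq_or_lt with rfl | hu
  · simp; linarith
  have hs : 0 < √u := Real.sqrt_pos.2 hu
  have h2 : √u * √u = u := Real.mul_self_sqrt hu.le
  have h3 : Real.log u = 2 * Real.log (√u) := by rw [Real.log_sqrt hu.le]; ring
  have h4 : u * Real.log u ^ 2 = 4 * (√u * Real.log (√u)) ^ 2 := by
    rw [h3]; nth_rewrite 1 [← h2]; ring
  have lo := Real.one_sub_inv_le_log_of_pos hs
  have hi := Real.log_le_sub_one_of_pos hs
  have lo' : √u - 1 ≤ √u * Real.log (√u) := by
    calc √u - 1 = √u * (1 - (√u)⁻¹) := by field_simp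
      _ ≤ _ := by gcongr
  rw [h4, mul_assoc]
  refine mul_le_mul_of_nonneg_left ?_ (by norm_num)
  rcases le_total 1 (√u) with h | h
  · have h0 : 0 ≤ √u * Real.log (√u) := by linarith
    calc (√u * Real.log √u) ^ 2 ≤ (√u * (√u - 1)) ^ 2 := by gcongr
      _ = u * (√u - 1) ^ 2 := by nth_rewrite 3 [← h2]; ring
      _ ≤ _ := by gcongr
  · have h0 : √u * Real.log √u ≤ 0 := mul_nonpos_of_nonneg_of_nonpos hs.le (by linarith)
    nlinarith [sq_nonneg (√u - 1)]

theorem abs_mul_log_sub_sub_sq_le {v : ℝ} (hv : |v| ≤ 1 / 2) :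
    |(1 + v) * Real.log (1 + v) - v - v ^ 2 / 2| ≤ 4 * |v| ^ 3 := by
  have h := Real.abs_log_sub_add_sum_range_le (x := -v) (by rw [abs_neg]; linarith) 2
  have e : (∑ i ∈ Finset.range 2, (-v) ^ (i + 1) / ((i : ℝ) + 1)) + Real.log (1 - -v)
      = Real.log (1 + v) - v + v ^ 2 / 2 := by
    simp [Finset.sum_range_succ]; ring
  rw [e, abs_neg] at h
  have h0 := abs_nonneg v
  have h2 : |v| ^ 3 / (1 - |v|) ≤ 2 * |v| ^ 3 := by
    rw [div_le_iff₀ (by linarith)]; nlinarith [pow_nonneg h0 3]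
  have h3 : |Real.log (1 + v) - v + v ^ 2 / 2| ≤ 2 * |v| ^ 3 := h.trans h2
  have e2 : (1 + v) * Real.log (1 + v) - v - v ^ 2 / 2
      = (1 + v) * (Real.log (1 + v) - v + v ^ 2 / 2) - v ^ 3 / 2 := by ring
  have h4 : |1 + v| ≤ 3 / 2 := by
    have := abs_le.1 hv; rw [abs_le]; constructor <;> linarith
  rw [e2]
  calc _ ≤ |1 + v| * |Real.log (1 + v) - v + v ^ 2 / 2| + |v| ^ 3 / 2 := by
        refine (abs_sub _ _).trans ?_
        rw [abs_mul, abs_div, abs_pow]; simp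
    _ ≤ 3 / 2 * (2 * |v| ^ 3) + |v| ^ 3 / 2 := by gcongr
    _ ≤ _ := by nlinarith [pow_nonneg h0 3]

/-- Near `1`, the function `u log u - u + 1` is quadratic up to a factor close to one. -/
theorem mul_log_scale_le {v r t : ℝ} (hr : r ≤ 1 / 16) (hv : |v| ≤ r) (ht0 : 0 ≤ t) (ht1 : t ≤ 1) :
    (1 + t * v) * Real.log (1 + t * v) - t * v
      ≤ t ^ 2 * (1 + 32 * r) * ((1 + v) * Real.log (1 + v) - v) := by
  have h0 := abs_nonneg v
  have htv : |t * v| = t * |v| := by rw [abs_mul, abs_of_nonneg ht0]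
  have a := abs_mul_log_sub_sub_sq_le (v := v) (by linarith)
  have b := abs_mul_log_sub_sub_sq_le (v := t * v) (by rw [htv]; nlinarith)
  have a' := (abs_le.1 a).1
  have b' := (abs_le.1 b).2
  rw [htv] at b'
  have e1 : |v| ^ 3 ≤ r * v ^ 2 := by
    rw [pow_succ', sq_abs]; gcongr
  have e2 : (t * |v|) ^ 3 ≤ t ^ 2 * (r * v ^ 2) := by
    calc (t * |v|) ^ 3 = t ^ 2 * (t * |v| ^ 3) := by ring
      _ ≤ t ^ 2 * (1 * (r * v ^ 2)) := by gcongr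
      _ = _ := by ring
  have u1 : (1 + t * v) * Real.log (1 + t * v) - t * v ≤ t ^ 2 * (v ^ 2 * (1 / 2 + 4 * r)) := by
    nlinarith
  have hr0 : 0 ≤ r := h0.trans hv
  refine u1.trans ?_
  rw [mul_assoc]
  refine mul_le_mul_of_nonneg_left ?_ (sq_nonneg t)
  have u2 : v ^ 2 * (1 / 2 - 4 * r) ≤ (1 + v) * Real.log (1 + v) - v := by nlinarith
  calc v ^ 2 * (1 / 2 + 4 * r) ≤ (1 + 32 * r) * (v ^ 2 * (1 / 2 - 4 * r)) := by
        nlinarith [sq_nonneg v, mul_nonneg (sq_nonneg v) (mul_nonneg hr0 (sub_nonneg.2 hr))]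
    _ ≤ _ := by gcongr

/-! ### Relative entropy and mutual information -/

section Information

variable {X Y : Type*} [Fintype X] [Fintype Y] {W : X → Y → ℝ} {P : X → ℝ}

theorem IsDist.le_one {q : Y → ℝ} (hq : IsDist q) (y : Y) : q y ≤ 1 :=
  hq.2 ▸ Finset.single_le_sum (fun z _ => hq.1 z) (Finset.mem_univ y)

theorem relEnt_nonneg {p q : Y → ℝ} (hp : IsDist p) (hq : IsDist q) (h : ∀ y, q y = 0 → p y = 0) :
    0 ≤ relEnt p q := by
  calc (0 : ℝ) = ∑ y, (p y - q y) := by rw [Finset.sum_sub_distrib, hp.2, hq.2, sub_self]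
    _ ≤ _ := Finset.sum_le_sum fun y _ => sub_le_mul_log_div (hp.1 y) (hq.1 y) (h y)

theorem relEnt_self {p : Y → ℝ} (hp : ∀ y, 0 < p y) : relEnt p p = 0 := by
  simp [relEnt, fun y => (hp y).ne']

theorem sum_outDist_mul (P : X → ℝ) (W : X → Y → ℝ) (G : Y → ℝ) :
    ∑ y, outDist P W y * G y = ∑ x, P x * ∑ y, W x y * G y := by
  simp_rw [outDist, Finset.sum_mul, Finset.mul_sum]
  rw [Finset.sum_comm]
  simp_rw [mul_assoc]

theorem isDist_outDist (hW : ∀ x, IsDist (W x)) (hP : IsDist P) : IsDist (outDist P W) := by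
  refine ⟨fun y => Finset.sum_nonneg fun x _ => mul_nonneg (hP.1 x) ((hW x).1 y), ?_⟩
  simpa [fun x => (hW x).2, hP.2] using sum_outDist_mul P W fun _ => 1

theorem mul_le_outDist (hW : ∀ x, IsDist (W x)) (hP : IsDist P) (x : X) (y : Y) :
    P x * W x y ≤ outDist P W y :=
  Finset.single_le_sum (f := fun x => P x * W x y) (fun x _ => mul_nonneg (hP.1 x) ((hW x).1 y))
    (Finset.mem_univ x)

theorem outDist_pos (hW : ∀ x, IsDist (W x)) (hP : IsDist P) {x : X} {y : Y}
    (h : P x * W x y ≠ 0) : 0 < outDist P W y :=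
  ((mul_nonneg (hP.1 x) ((hW x).1 y)).lt_of_ne h.symm).trans_le (mul_le_outDist hW hP x y)

theorem mutInfo_eq_sum (P : X → ℝ) (W : X → Y → ℝ) :
    mutInfo P W = ∑ x, P x * ∑ y, W x y * Real.log (W x y / outDist P W y) := by
  simp_rw [mutInfo, Finset.mul_sum, mul_assoc]

theorem mutInfo_nonneg (hW : ∀ x, IsDist (W x)) (hP : IsDist P) : 0 ≤ mutInfo P W := by
  rw [mutInfo_eq_sum]
  refine Finset.sum_nonneg fun x _ => ?_
  rcases (hP.1 x).eq_or_lt with h | h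
  · simp [← h]
  refine mul_nonneg h.le (relEnt_nonneg (hW x) (isDist_outDist hW hP) fun y hy => ?_)
  by_contra h'
  exact (outDist_pos hW hP (mul_ne_zero h.ne' h')).ne' hy

theorem mutInfo_le_card (hW : ∀ x, IsDist (W x)) (hP : IsDist P) :
    mutInfo P W ≤ ∑ _x : X, ∑ _y : Y, 1 := by
  refine Finset.sum_le_sum fun x _ => Finset.sum_le_sum fun y _ => ?_
  have hPW := mul_nonneg (hP.1 x) ((hW x).1 y)
  rcases hPW.eq_or_lt with h | h
  · simp [← h]
  have hW0 : 0 < W x y := ((hW x).1 y).lt_of_ne fun h' => h.ne' (by simp [← h'])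
  have hP0 : 0 < P x := (hP.1 x).lt_of_ne fun h' => h.ne' (by simp [← h'])
  have hle : W x y / outDist P W y ≤ (P x)⁻¹ := by
    rw [div_le_iff₀ (outDist_pos hW hP h.ne'), inv_mul_eq_div, le_div_iff₀ hP0, mul_comm]
    exact mul_le_outDist hW hP x y
  have hlog : Real.log (W x y / outDist P W y) ≤ (P x)⁻¹ :=
    (Real.log_le_self (div_nonneg hW0.le (isDist_outDist hW hP |>.1 y))).trans hle
  calc P x * W x y * Real.log (W x y / outDist P W y) ≤ P x * W x y * (P x)⁻¹ := by gcongr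
    _ = W x y := by field_simp
    _ ≤ 1 := (hW x).le_one y

theorem mutInfo_le_of_dist (hW : ∀ x, IsDist (W x)) (hP : IsDist P) {R : Y → ℝ} (hR : IsDist R)
    (h : ∀ y, R y = 0 → outDist P W y = 0) :
    mutInfo P W ≤ ∑ x, P x * ∑ y, W x y * Real.log (W x y / R y) := by
  have h0 := relEnt_nonneg (isDist_outDist hW hP) hR h
  rw [relEnt, sum_outDist_mul] at h0
  suffices ∑ x, P x * ∑ y, W x y * Real.log (W x y / R y)
      = mutInfo P W + ∑ x, P x * ∑ y, W x y * Real.log (outDist P W y / R y) by linarith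
  rw [mutInfo_eq_sum, ← Finset.sum_add_distrib]
  refine Finset.sum_congr rfl fun x _ => ?_
  rw [← mul_add, ← Finset.sum_add_distrib, Finset.mul_sum, Finset.mul_sum]
  refine Finset.sum_congr rfl fun y _ => ?_
  by_cases hPW : P x * W x y = 0
  · rcases mul_eq_zero.1 hPW with h | h <;> simp [h]
  have hQ := (outDist_pos hW hP hPW).ne'
  have hR' : R y ≠ 0 := fun h' => hQ (h y h')
  rw [Real.log_div (right_ne_zero_of_mul hPW) hR', Real.log_div (right_ne_zero_of_mul hPW) hQ,
    Real.log_div hQ hR']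
  ring

/-- Time sharing between `P` and the constant input `x0`. -/
theorem exists_mixture (hW : ∀ x, IsDist (W x)) (x0 : X) (hP : IsDist P) {t : ℝ} (ht0 : 0 < t)
    (ht1 : t < 1) :
    ∃ P' : X → ℝ, IsDist P' ∧ (∀ y, outDist P' W y = (1 - t) * W x0 y + t * outDist P W y) ∧
      t * mutInfo P W ≤ mutInfo P' W := by
  classical
  let P' : X → ℝ := fun x => (1 - t) * (if x = x0 then 1 else 0) + t * P x
  have hsum : ∀ F : X → ℝ, ∑ x, P' x * F x = (1 - t) * F x0 + t * ∑ x, P x * F x := by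
    intro F
    simp [P', add_mul, Finset.sum_add_distrib, Finset.mul_sum, mul_assoc]
  have hP' : IsDist P' := by
    refine ⟨fun x => ?_, ?_⟩
    · have := hP.1 x
      have : (0 : ℝ) ≤ if x = x0 then 1 else 0 := by split_ifs <;> norm_num
      have : 0 ≤ 1 - t := by linarith
      positivity
    · simpa [hP.2] using hsum fun _ => 1
  have hout : ∀ y, outDist P' W y = (1 - t) * W x0 y + t * outDist P W y := fun y =>
    hsum fun x => W x y
  refine ⟨P', hP', hout, ?_⟩
  have hQ' := isDist_outDist hW hP'
  have hQ := isDist_outDist hW hP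
  have hz : ∀ y, outDist P' W y = 0 → W x0 y = 0 ∧ outDist P W y = 0 := by
    intro y hy
    rw [hout] at hy
    have h1 := (hW x0).1 y
    have h2 := hQ.1 y
    have h3 := mul_nonneg (sub_nonneg.2 ht1.le) h1
    have h4 := mul_nonneg ht0.le h2
    constructor
    · exact (mul_eq_zero.1 (by linarith : (1 - t) * W x0 y = 0)).resolve_left (by linarith)
    · exact (mul_eq_zero.1 (by linarith : t * outDist P W y = 0)).resolve_left ht0.ne'
  rw [mutInfo_eq_sum P' W, hsum]
  have a := mutInfo_le_of_dist hW hP hQ' fun y hy => (hz y hy).2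
  have b : 0 ≤ ∑ y, W x0 y * Real.log (W x0 y / outDist P' W y) :=
    relEnt_nonneg (hW x0) hQ' fun y hy => (hz y hy).1
  have c := mul_nonneg (sub_nonneg.2 ht1.le) b
  have d := mul_le_mul_of_nonneg_left a ht0.le
  linarith

theorem relEnt_eq_sum {q q0 : Y → ℝ} (hq : IsDist q) (hq0 : IsDist q0) (hpos : ∀ y, 0 < q0 y) :
    relEnt q q0
      = ∑ y, q0 y * ((1 + (q y / q0 y - 1)) * Real.log (1 + (q y / q0 y - 1)) -
          (q y / q0 y - 1)) := by
  have h : ∀ y, q0 y * ((1 + (q y / q0 y - 1)) * Real.log (1 + (q y / q0 y - 1)) -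
      (q y / q0 y - 1)) = q y * Real.log (q y / q0 y) - (q y - q0 y) := by
    intro y
    have := (hpos y).ne'
    rw [add_sub_cancel]
    field_simp
  simp_rw [h, Finset.sum_sub_distrib, hq.2, hq0.2]
  simp [relEnt]

theorem exists_inv_bound {q0 : Y → ℝ} (hpos : ∀ y, 0 < q0 y) :
    ∃ B : ℝ, 1 ≤ B ∧ ∀ y, (q0 y)⁻¹ ≤ B := by
  refine ⟨1 + ∑ y, (q0 y)⁻¹, ?_, fun y => ?_⟩
  · exact le_add_of_nonneg_right (Finset.sum_nonneg fun y _ => (inv_pos.2 (hpos y)).le)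
  · have := Finset.single_le_sum (f := fun y => (q0 y)⁻¹) (fun y _ => (inv_pos.2 (hpos y)).le)
      (Finset.mem_univ y)
    linarith

theorem abs_div_sub_one_le {q q0 : Y → ℝ} (hq : IsDist q) (hq0 : IsDist q0) (hpos : ∀ y, 0 < q0 y)
    {B : ℝ} (hB : 1 ≤ B) (hB' : ∀ y, (q0 y)⁻¹ ≤ B) {d r : ℝ} (hr : 0 ≤ r)
    (hd : relEnt q q0 ≤ d) (hdr : 4 * B ^ 2 * d ≤ r ^ 2) (y : Y) :
    |q y / q0 y - 1| ≤ r := by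
  set φ : Y → ℝ := fun y => q y / q0 y * Real.log (q y / q0 y) - q y / q0 y + 1 with hφ
  have hu : ∀ y, 0 ≤ q y / q0 y := fun y => div_nonneg (hq.1 y) (hpos y).le
  have h0 : ∀ y, 0 ≤ φ y := fun y => (sq_nonneg _).trans (sq_sqrt_sub_one_le (hu y))
  have h1 : q0 y * φ y ≤ d := by
    refine le_trans ?_ hd
    rw [relEnt_eq_sum hq hq0 hpos]
    have e : ∀ y, q0 y * ((1 + (q y / q0 y - 1)) * Real.log (1 + (q y / q0 y - 1)) -
        (q y / q0 y - 1)) = q0 y * φ y := by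
      intro y; rw [add_sub_cancel, hφ]; ring
    simp_rw [e]
    exact Finset.single_le_sum (f := fun y => q0 y * φ y)
      (fun y _ => mul_nonneg (hpos y).le (h0 y)) (Finset.mem_univ y)
  have hB0 : 0 ≤ B := by linarith
  have h2 : φ y ≤ B * d := by
    calc φ y = (q0 y)⁻¹ * (q0 y * φ y) := by rw [inv_mul_cancel_left₀ (hpos y).ne']
      _ ≤ B * d := mul_le_mul (hB' y) h1 (mul_nonneg (hpos y).le (h0 y)) hB0
  have huB : q y / q0 y ≤ B := by
    rw [div_eq_mul_inv]
    calc q y * (q0 y)⁻¹ ≤ 1 * (q0 y)⁻¹ :=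
          mul_le_mul_of_nonneg_right (hq.le_one y) (inv_pos.2 (hpos y)).le
      _ ≤ B := by rw [one_mul]; exact hB' y
  have h3 := sq_sub_one_le (hu y) hB huB
  refine abs_le_of_sq_le_sq ?_ hr
  calc _ ≤ 4 * B * φ y := h3
    _ ≤ 4 * B * (B * d) := by gcongr
    _ = 4 * B ^ 2 * d := by ring
    _ ≤ _ := hdr

theorem relEnt_mixture_le {q q0 q' : Y → ℝ} (hq : IsDist q) (hq0 : IsDist q0) (hq' : IsDist q')
    (hpos : ∀ y, 0 < q0 y) {t r : ℝ} (ht0 : 0 ≤ t) (ht1 : t ≤ 1)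
    (h : ∀ y, q' y = (1 - t) * q0 y + t * q y) (hr : r ≤ 1 / 16)
    (hqr : ∀ y, |q y / q0 y - 1| ≤ r) :
    relEnt q' q0 ≤ t ^ 2 * (1 + 32 * r) * relEnt q q0 := by
  rw [relEnt_eq_sum hq' hq0 hpos, relEnt_eq_sum hq hq0 hpos, Finset.mul_sum]
  refine Finset.sum_le_sum fun y _ => ?_
  have e : q' y / q0 y - 1 = t * (q y / q0 y - 1) := by
    have := (hpos y).ne'
    rw [h]; field_simp; ring
  rw [e, mul_left_comm]
  exact mul_le_mul_of_nonneg_left (mul_log_scale_le hr (hqr y) ht0 ht1) (hpos y).le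

/-- The second moment of the information density is controlled by the mutual information. -/
theorem sum_mul_log_sq_le (hW : ∀ x, IsDist (W x)) (hP : IsDist P) {B : ℝ} (hB : 1 ≤ B)
    (hQ : ∀ y, 0 < outDist P W y) (h : ∀ y, (outDist P W y)⁻¹ ≤ B) :
    ∑ x, ∑ y, P x * W x y * Real.log (W x y / outDist P W y) ^ 2 ≤ 4 * B * mutInfo P W := by
  set Q := outDist P W
  have hQd : IsDist Q := isDist_outDist hW hP
  have e : mutInfo P W = ∑ x, ∑ y, P x * Q y *
      (W x y / Q y * Real.log (W x y / Q y) - W x y / Q y + 1) := by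
    have e1 : ∀ x y, P x * Q y * (W x y / Q y * Real.log (W x y / Q y) - W x y / Q y + 1)
        = P x * W x y * Real.log (W x y / Q y) - P x * W x y + P x * Q y := by
      intro x y
      have := (hQ y).ne'
      field_simp
    simp_rw [e1, Finset.sum_add_distrib, Finset.sum_sub_distrib, ← Finset.mul_sum, (hW _).2, hQd.2]
    simp [mutInfo, Q]
  rw [e, Finset.mul_sum]
  refine Finset.sum_le_sum fun x _ => ?_
  rw [Finset.mul_sum]
  refine Finset.sum_le_sum fun y _ => ?_
  have hu : 0 ≤ W x y / Q y := div_nonneg ((hW x).1 y) (hQ y).le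
  have huB : W x y / Q y ≤ B := by
    rw [div_eq_mul_inv]
    calc W x y * (Q y)⁻¹ ≤ 1 * (Q y)⁻¹ :=
          mul_le_mul_of_nonneg_right ((hW x).le_one y) (inv_pos.2 (hQ y)).le
      _ ≤ B := by rw [one_mul]; exact h y
  have := mul_le_mul_of_nonneg_left (mul_log_sq_le hu hB huB) (mul_nonneg (hP.1 x) (hQ y).le)
  have e2 : P x * Q y * (W x y / Q y * Real.log (W x y / Q y) ^ 2)
      = P x * W x y * Real.log (W x y / Q y) ^ 2 := by
    have := (hQ y).ne'
    field_simp
  rw [e2] at this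
  linarith

end Information

/-! ### Converse -/

section Converse

variable {Ω X Y : Type*} [Fintype Ω] [Fintype X] [Fintype Y] {W : X → Y → ℝ} {P : X → ℝ}
  {w : Ω → ℝ} {n : ℕ} {word : Ω → Fin n → X}

theorem exists_letter_average (hw : IsDist w) (hn : 0 < n) (word : Ω → Fin n → X) :
    ∃ P : X → ℝ, IsDist P ∧
      ∀ F : X → ℝ, n * ∑ x, P x * F x = ∑ ω, w ω * ∑ i, F (word ω i) := by
  classical
  have hn' : (0 : ℝ) < n := by exact_mod_cast hn
  let P : X → ℝ := fun x => (n : ℝ)⁻¹ * ∑ ω, w ω * ∑ i, if word ω i = x then 1 else 0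
  have h : ∀ F : X → ℝ, n * ∑ x, P x * F x = ∑ ω, w ω * ∑ i, F (word ω i) := by
    intro F
    have e : ∀ x, P x * F x
        = (n : ℝ)⁻¹ * ∑ ω, w ω * ∑ i, if word ω i = x then F x else 0 := by
      intro x
      simp only [P, mul_assoc, Finset.sum_mul, ite_mul, one_mul, zero_mul]
    simp_rw [e, ← Finset.mul_sum]
    rw [mul_inv_cancel_left₀ hn'.ne', Finset.sum_comm]
    refine Finset.sum_congr rfl fun ω _ => ?_
    rw [← Finset.mul_sum, Finset.sum_comm]
    simp
  refine ⟨P, ⟨fun x => ?_, ?_⟩, h⟩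
  · exact mul_nonneg (inv_nonneg.2 hn'.le) (Finset.sum_nonneg fun ω _ => mul_nonneg (hw.1 ω)
      (Finset.sum_nonneg fun i _ => by split_ifs <;> norm_num))
  · have := h fun _ => 1
    simp only [mul_one, Finset.sum_const, Finset.card_univ, Fintype.card_fin, nsmul_eq_mul,
      ← Finset.sum_mul, hw.2, one_mul] at this
    exact mul_left_cancel₀ hn'.ne' (by rw [this, mul_one])

theorem sum_word_mul_sum (hW : ∀ x, IsDist (W x))
    (hP : ∀ F : X → ℝ, n * ∑ x, P x * F x = ∑ ω, w ω * ∑ i, F (word ω i)) (G : X → Y → ℝ) :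
    ∑ ω, ∑ ys : Fin n → Y, (w ω * ∏ i, W (word ω i) (ys i)) * ∑ i, G (word ω i) (ys i)
      = n * ∑ x, P x * ∑ y, W x y * G x y := by
  rw [hP]
  refine Finset.sum_congr rfl fun ω _ => ?_
  simp_rw [mul_assoc, ← Finset.mul_sum]
  congr 1
  simp_rw [Finset.mul_sum]
  rw [Finset.sum_comm]
  exact Finset.sum_congr rfl fun i _ =>
    sum_prod_pi_mul (p := fun i => W (word ω i)) (fun i => (hW _).2) i (G (word ω i))

theorem outDist_pos_of_word (hW : ∀ x, IsDist (W x)) (hw : IsDist w)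
    (hP : ∀ F : X → ℝ, n * ∑ x, P x * F x = ∑ ω, w ω * ∑ i, F (word ω i)) {ω : Ω}
    {ys : Fin n → Y} (h : w ω * ∏ i, W (word ω i) (ys i) ≠ 0) (i : Fin n) :
    0 < outDist P W (ys i) := by
  have hWi : ∀ i, 0 < W (word ω i) (ys i) := fun i => ((hW _).1 _).lt_of_ne
    (Finset.prod_ne_zero_iff.1 (right_ne_zero_of_mul h) i (Finset.mem_univ i)).symm
  have hwω : 0 < w ω := (hw.1 ω).lt_of_ne (left_ne_zero_of_mul h).symm
  have h1 : 0 < ∑ ω, w ω * ∑ k, W (word ω k) (ys i) := by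
    refine Finset.sum_pos' (fun ω _ => mul_nonneg (hw.1 ω) (Finset.sum_nonneg fun k _ => (hW _).1 _))
      ⟨ω, Finset.mem_univ ω, mul_pos hwω ?_⟩
    exact Finset.sum_pos' (fun k _ => (hW _).1 _) ⟨i, Finset.mem_univ i, hWi i⟩
  rw [← hP fun x => W x (ys i)] at h1
  exact pos_of_mul_pos_right h1 (Nat.cast_nonneg n)

theorem card_mul_relEnt_le (hW : ∀ x, IsDist (W x)) (hw : IsDist w) (hPd : IsDist P)
    (hP : ∀ F : X → ℝ, n * ∑ x, P x * F x = ∑ ω, w ω * ∑ i, F (word ω i)) {q0 : Y → ℝ}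
    (hpos : ∀ y, 0 < q0 y) :
    n * relEnt (outDist P W) q0
      ≤ relEnt (fun ys : Fin n → Y => ∑ ω, w ω * ∏ i, W (word ω i) (ys i))
          (fun ys => ∏ i, q0 (ys i)) := by
  set Q := outDist P W
  have hQ : IsDist Q := isDist_outDist hW hPd
  set Z : (Fin n → Y) → ℝ := fun ys => ∑ ω, w ω * ∏ i, W (word ω i) (ys i) with hZ
  have hterm : ∀ ω (ys : Fin n → Y), 0 ≤ w ω * ∏ i, W (word ω i) (ys i) := fun ω ys =>
    mul_nonneg (hw.1 ω) (Finset.prod_nonneg fun i _ => (hW _).1 _)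
  have hZ0 : ∀ ys, 0 ≤ Z ys := fun ys => Finset.sum_nonneg fun ω _ => hterm ω ys
  have hZ1 : ∑ ys, Z ys = 1 := by
    rw [hZ, Finset.sum_comm]
    simp_rw [← Finset.mul_sum]
    rw [← hw.2]
    refine Finset.sum_congr rfl fun ω _ => ?_
    rw [sum_prod_pi_eq_one (p := fun i => W (word ω i)) fun i => (hW _).2, mul_one]
  have hR1 : ∑ ys : Fin n → Y, ∏ i, Q (ys i) = 1 := sum_prod_pi_eq_one (p := fun _ => Q) fun _ => hQ.2
  have hsup : ∀ ys, Z ys ≠ 0 → ∀ i, 0 < Q (ys i) := by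
    intro ys h
    obtain ⟨ω, -, hω⟩ := Finset.exists_ne_zero_of_sum_ne_zero h
    exact outDist_pos_of_word hW hw hP hω
  have hlin : ∑ ys, Z ys * ∑ i, Real.log (Q (ys i) / q0 (ys i)) = n * relEnt Q q0 := by
    have := sum_word_mul_sum hW hP fun _ y => Real.log (Q y / q0 y)
    rw [relEnt, sum_outDist_mul, ← this, Finset.sum_comm]
    simp_rw [hZ, Finset.sum_mul]
  have key : ∀ ys, Z ys - ∏ i, Q (ys i) + Z ys * ∑ i, Real.log (Q (ys i) / q0 (ys i))
      ≤ Z ys * Real.log (Z ys / ∏ i, q0 (ys i)) := by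
    intro ys
    by_cases h : Z ys = 0
    · simpa [h] using Finset.prod_nonneg fun i _ => hQ.1 (ys i)
    have hR : 0 < ∏ i, Q (ys i) := Finset.prod_pos fun i _ => hsup ys h i
    have h0 : 0 < ∏ i, q0 (ys i) := Finset.prod_pos fun i _ => hpos _
    have h1 := sub_le_mul_log_div (hZ0 ys) hR.le fun h' => absurd h' hR.ne'
    rw [← Real.log_prod fun i _ => (div_pos (hsup ys h i) (hpos _)).ne', Finset.prod_div_distrib,
      Real.log_div hR.ne' h0.ne', Real.log_div h h0.ne']
    rw [Real.log_div h hR.ne'] at h1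
    linarith
  have := Finset.sum_le_sum fun ys (_ : ys ∈ Finset.univ) => key ys
  rw [Finset.sum_add_distrib, Finset.sum_sub_distrib, hZ1, hR1, hlin] at this
  simpa [relEnt] using this

theorem sum_sum_sub_linear {α β : Type*} [Fintype α] [Fintype β] (v a b : α → β → ℝ) (s t : ℝ) :
    ∑ i, ∑ j, (v i j - (s * a i j + t * b i j))
      = ∑ i, ∑ j, v i j - (s * ∑ i, ∑ j, a i j + t * ∑ i, ∑ j, b i j) := by
  simp_rw [Finset.mul_sum, ← Finset.sum_add_distrib, ← Finset.sum_sub_distrib]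

theorem sum_sum_sub_mul_add {α β : Type*} [Fintype α] [Fintype β] (u v c : α → β → ℝ) (s t : ℝ) :
    ∑ i, ∑ j, (u i j - s * (v i j - c i j) + v i j * t)
      = ∑ i, ∑ j, u i j - s * (∑ i, ∑ j, v i j - ∑ i, ∑ j, c i j) + (∑ i, ∑ j, v i j) * t := by
  simp_rw [← Finset.sum_sub_distrib, Finset.mul_sum, Finset.sum_mul, ← Finset.sum_sub_distrib,
    ← Finset.sum_add_distrib]

/-- Fano's inequality, in terms of the single-letter averaged mutual information. -/
theorem fano (hW : ∀ x, IsDist (W x)) (hw : IsDist w) (hPd : IsDist P)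
    (hP : ∀ F : X → ℝ, n * ∑ x, P x * F x = ∑ ω, w ω * ∑ i, F (word ω i)) {m : ℕ} (hm : 0 < m)
    (E : Ω → (Fin n → Y) → Prop) [∀ ω ys, Decidable (E ω ys)]
    (hE : ∀ R : (Fin n → Y) → ℝ, ∑ ys, R ys = 1 →
      ∑ ω, ∑ ys, w ω * R ys * (if E ω ys then 1 else 0) = (m : ℝ)⁻¹) {ε : ℝ}
    (hε : ∑ ω, w ω * ∑ ys : Fin n → Y, (if E ω ys then 0 else ∏ i, W (word ω i) (ys i)) ≤ ε) :
    (1 - ε) * Real.log m - Real.log 2 ≤ n * mutInfo P W := by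
  have hm' : (0 : ℝ) < m := by exact_mod_cast hm
  set Q := outDist P W
  have hQ : IsDist Q := isDist_outDist hW hPd
  set R : (Fin n → Y) → ℝ := fun ys => ∏ i, Q (ys i) with hR
  have hR0 : ∀ ys, 0 ≤ R ys := fun ys => Finset.prod_nonneg fun i _ => hQ.1 _
  have hR1 : ∑ ys, R ys = 1 := sum_prod_pi_eq_one (p := fun _ => Q) fun _ => hQ.2
  set V : Ω → (Fin n → Y) → ℝ := fun ω ys => w ω * ∏ i, W (word ω i) (ys i) with hV
  have hV0 : ∀ ω ys, 0 ≤ V ω ys := fun ω ys =>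
    mul_nonneg (hw.1 ω) (Finset.prod_nonneg fun i _ => (hW _).1 _)
  have hV1 : ∑ ω, ∑ ys, V ω ys = 1 := by
    rw [← hw.2]
    refine Finset.sum_congr rfl fun ω _ => ?_
    rw [← Finset.mul_sum, sum_prod_pi_eq_one (p := fun i => W (word ω i)) fun i => (hW _).2,
      mul_one]
  have hI : ∑ ω, ∑ ys, V ω ys * ∑ i, Real.log (W (word ω i) (ys i) / Q (ys i))
      = n * mutInfo P W := by
    rw [mutInfo_eq_sum]
    exact sum_word_mul_sum hW hP fun x y => Real.log (W x y / Q y)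
  have hwR : ∑ ω, ∑ ys, w ω * R ys = 1 := by
    simp_rw [← Finset.mul_sum, hR1, mul_one, hw.2]
  have key : ∀ ω ys,
      V ω ys - (m / 2 * (w ω * R ys * (if E ω ys then 1 else 0)) + 1 / 2 * (w ω * R ys))
        ≤ V ω ys * ∑ i, Real.log (W (word ω i) (ys i) / Q (ys i))
          - Real.log m * (V ω ys - w ω * (if E ω ys then 0 else ∏ i, W (word ω i) (ys i)))
          + V ω ys * Real.log 2 := by
    intro ω ys
    have hwR0 : 0 ≤ w ω * R ys := mul_nonneg (hw.1 ω) (hR0 ys)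
    by_cases h : V ω ys = 0
    · have h' : w ω * (if E ω ys then 0 else ∏ i, W (word ω i) (ys i)) = 0 := by
        split_ifs
        · simp
        · exact h
      rw [h', h]
      have : (0 : ℝ) ≤ if E ω ys then 1 else 0 := by split_ifs <;> norm_num
      have : 0 ≤ m / 2 * (w ω * R ys * (if E ω ys then (1 : ℝ) else 0)) + 1 / 2 * (w ω * R ys) := by
        positivity
      simp only [zero_mul, sub_zero, mul_zero, add_zero, zero_sub, neg_nonpos]
      exact this
    have hQi := outDist_pos_of_word hW hw hP h
    have hRp : 0 < R ys := Finset.prod_pos fun i _ => hQi i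
    have hwp : 0 < w ω := (hw.1 ω).lt_of_ne (left_ne_zero_of_mul h).symm
    have hprod : ∏ i, W (word ω i) (ys i) ≠ 0 := right_ne_zero_of_mul h
    have hWi : ∀ i ∈ Finset.univ, W (word ω i) (ys i) / Q (ys i) ≠ 0 := fun i hi =>
      div_ne_zero (Finset.prod_ne_zero_iff.1 hprod i hi) (hQi i).ne'
    rw [← Real.log_prod hWi, Finset.prod_div_distrib, Real.log_div hprod hRp.ne']
    have hVl : Real.log (V ω ys) = Real.log (w ω) + Real.log (∏ i, W (word ω i) (ys i)) :=
      Real.log_mul hwp.ne' hprod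
    have aux : ∀ g : ℝ, 0 < g → V ω ys - w ω * R ys * g / 2
        ≤ V ω ys * (Real.log (∏ i, W (word ω i) (ys i)) - Real.log (R ys))
          - V ω ys * Real.log g + V ω ys * Real.log 2 := by
      intro g hg
      have hr : 0 < w ω * R ys * g / 2 := by positivity
      have := sub_le_mul_log_div (hV0 ω ys) hr.le fun h' => absurd h' hr.ne'
      rw [Real.log_div h hr.ne', Real.log_div (by positivity) two_ne_zero,
        Real.log_mul (by positivity) hg.ne', Real.log_mul hwp.ne' hRp.ne', hVl] at this
      linarith
    by_cases hc : E ω ys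
    · have := aux m hm'
      simp only [hc, if_true, mul_zero, sub_zero, mul_one]
      linarith [mul_nonneg (hw.1 ω) (hR0 ys)]
    · have := aux 1 one_pos
      simp only [hc, if_false, mul_zero, zero_add, Real.log_one, mul_one, sub_zero] at this ⊢
      change _ ≤ _ - Real.log m * (V ω ys - V ω ys) + _
      linarith
  have hs := Finset.sum_le_sum fun ω (_ : ω ∈ Finset.univ) =>
    Finset.sum_le_sum fun ys (_ : ys ∈ Finset.univ) => key ω ys
  rw [sum_sum_sub_linear, sum_sum_sub_mul_add, hV1, hwR, hE R hR1, hI] at hs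
  simp_rw [← Finset.mul_sum] at hs
  have hmm : (m : ℝ) / 2 * (m : ℝ)⁻¹ = 1 / 2 := by field_simp
  rw [hmm] at hs
  have hlog : 0 ≤ Real.log m := Real.log_natCast_nonneg m
  nlinarith [mul_le_mul_of_nonneg_left hε hlog]

theorem converse [DecidableEq Y] {x0 : X} (hW : ∀ x, IsDist (W x)) (hsupp : ∀ y, 0 < W x0 y)
    (hn : 0 < n) {m : ℕ} (hm : 0 < m) {δ ε : ℝ}
    {ρ : (Fin m → Fin n → X) × ((Fin n → Y) → Fin m) → ℝ} (hρ : IsDist ρ)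
    (hδ : relEnt (codeOut W ρ) (fun ys : Fin n → Y => ∏ i, W x0 (ys i)) ≤ δ)
    (hε : codeErr W ρ ≤ ε) :
    ∃ P : X → ℝ, IsDist P ∧ relEnt (outDist P W) (W x0) ≤ δ / n ∧
      (1 - ε) * Real.log m - Real.log 2 ≤ n * mutInfo P W := by
  have hm' : (0 : ℝ) < m := by exact_mod_cast hm
  have hn' : (0 : ℝ) < n := by exact_mod_cast hn
  let w : ((Fin m → Fin n → X) × ((Fin n → Y) → Fin m)) × Fin m → ℝ := fun ω => ρ ω.1 * (m : ℝ)⁻¹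
  have hw : IsDist w := by
    refine ⟨fun ω => mul_nonneg (hρ.1 _) (by positivity), ?_⟩
    rw [Fintype.sum_prod_type]
    simp [w, hρ.2, ← Finset.mul_sum, ← Finset.sum_mul, hm'.ne']
  obtain ⟨P, hPd, hP⟩ := exists_letter_average hw hn fun ω => ω.1.1 ω.2
  refine ⟨P, hPd, ?_, ?_⟩
  · rw [le_div_iff₀' hn']
    refine (card_mul_relEnt_le hW hw hPd hP hsupp).trans (le_of_eq_of_le ?_ hδ)
    congr 1
    funext ys
    simp only [codeOut, w, Fintype.sum_prod_type (α₂ := Fin m), Finset.mul_sum, mul_assoc]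
  · refine fano hW hw hPd hP hm (fun ω ys => ω.1.2 ys = ω.2) ?_ (le_of_eq_of_le ?_ hε)
    · intro R hR
      rw [Fintype.sum_prod_type]
      have : ∀ c : (Fin m → Fin n → X) × ((Fin n → Y) → Fin m), ∑ j, ∑ ys,
          w (c, j) * R ys * (if c.2 ys = j then 1 else 0) = ρ c * (m : ℝ)⁻¹ := by
        intro c
        rw [Finset.sum_comm]
        simp only [w]
        simp [← Finset.mul_sum, hR]
      simp_rw [this, ← Finset.sum_mul, hρ.2, one_mul]
    · simp only [codeErr, w, Fintype.sum_prod_type (α₂ := Fin m), Finset.mul_sum, mul_assoc]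

end Converse

/-! ### Achievability -/

theorem outDist_prod {X Y : Type*} [Fintype X] (P : X → ℝ) (W : X → Y → ℝ) {n : ℕ} (ys : Fin n → Y) :
    outDist (fun xs : Fin n → X => ∏ i, P (xs i)) (fun xs ys => ∏ i, W (xs i) (ys i)) ys
      = ∏ i, outDist P W (ys i) := by
  simp only [outDist, ← Finset.prod_mul_distrib]
  exact sum_prod_pi fun i x => P x * W x (ys i)

theorem ite_le_one_zero_of_imp {p q : Prop} [Decidable p] [Decidable q] (h : p → q) :
    (if p then (1 : ℝ) else 0) ≤ if q then 1 else 0 := by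
  split_ifs with hp hq
  · exact le_rfl
  · exact absurd (h hp) hq
  · exact zero_le_one
  · exact le_rfl

section Achievability

variable {X Y : Type*} [Fintype X] [Fintype Y] {W : X → Y → ℝ} {P : X → ℝ}

theorem relEnt_prod {q q0 : Y → ℝ} (hq : IsDist q) (hq' : ∀ y, 0 < q y) (hpos : ∀ y, 0 < q0 y)
    (n : ℕ) :
    relEnt (fun ys : Fin n → Y => ∏ i, q (ys i)) (fun ys => ∏ i, q0 (ys i)) = n * relEnt q q0 := by
  have h : ∀ ys : Fin n → Y, (∏ i, q (ys i)) * Real.log ((∏ i, q (ys i)) / ∏ i, q0 (ys i))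
      = ∑ j, (∏ i, q (ys i)) * Real.log (q (ys j) / q0 (ys j)) := by
    intro ys
    rw [← Finset.prod_div_distrib, Real.log_prod fun i _ => (div_pos (hq' _) (hpos _)).ne',
      Finset.mul_sum]
  simp_rw [relEnt, h]
  rw [Finset.sum_comm]
  simp_rw [fun j : Fin n => sum_prod_pi_mul (p := fun _ : Fin n => q) (fun _ => hq.2) j
    fun y => Real.log (q y / q0 y)]
  simp

open Classical in
/-- Random coding with a threshold decoder. -/
theorem exists_threshold_decoder {α β : Type*} [Fintype α] [Fintype β] {V : α → β → ℝ} {p : α → ℝ}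
    (hV : ∀ a, IsDist (V a)) (hp : IsDist p) {m : ℕ} (hm : 0 < m) {τ : ℝ} (hτ : 0 < τ) :
    ∃ dec : (Fin m → α) → β → Fin m, ∀ j : Fin m,
      ∑ f : Fin m → α, (∏ i, p (f i)) * ∑ b, (if dec f b = j then 0 else V (f j) b)
        ≤ (∑ a, p a * ∑ b, V a b * if V a b ≤ τ * outDist p V b then 1 else 0)
          + (m - 1) * τ⁻¹ := by
  set q := outDist p V with hq
  have hqd : IsDist q := isDist_outDist hV hp
  let dec : (Fin m → α) → β → Fin m := fun f b =>
    if h : ∃ k, τ * q b < V (f k) b then h.choose else ⟨0, hm⟩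
  refine ⟨dec, fun j => ?_⟩
  have hpt : ∀ f b, (if dec f b = j then 0 else V (f j) b)
      ≤ V (f j) b * (if V (f j) b ≤ τ * q b then 1 else 0)
        + ∑ k ∈ Finset.univ.erase j, V (f j) b * (if τ * q b < V (f k) b then 1 else 0) := by
    intro f b
    have hnn := (hV (f j)).1 b
    have h1 : ∀ k, 0 ≤ V (f j) b * (if τ * q b < V (f k) b then 1 else 0) := fun k =>
      mul_nonneg hnn (by split_ifs <;> norm_num)
    have h2 : 0 ≤ V (f j) b * (if V (f j) b ≤ τ * q b then 1 else 0) :=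
      mul_nonneg hnn (by split_ifs <;> norm_num)
    have h3 := Finset.sum_nonneg fun k (_ : k ∈ Finset.univ.erase j) => h1 k
    by_cases hd : dec f b = j
    · rw [if_pos hd]; exact add_nonneg h2 h3
    rw [if_neg hd]
    by_cases hle : V (f j) b ≤ τ * q b
    · rw [if_pos hle, mul_one]; exact le_add_of_nonneg_right h3
    · have hex : ∃ k, τ * q b < V (f k) b := ⟨j, not_le.1 hle⟩
      have hdec : dec f b = hex.choose := dif_pos hex
      have hk : dec f b ∈ Finset.univ.erase j := Finset.mem_erase.2 ⟨hd, Finset.mem_univ _⟩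
      have hlt : τ * q b < V (f (dec f b)) b := by rw [hdec]; exact hex.choose_spec
      have := Finset.single_le_sum (fun k _ => h1 k) hk
      rw [if_pos hlt] at this
      linarith
  have hpair : ∀ k ∈ Finset.univ.erase j,
      ∑ f : Fin m → α, (∏ i, p (f i)) *
        ∑ b, V (f j) b * (if τ * q b < V (f k) b then 1 else 0) ≤ τ⁻¹ := by
    intro k hk
    have hjk : j ≠ k := (Finset.ne_of_mem_erase hk).symm
    simp_rw [Finset.mul_sum]
    rw [Finset.sum_comm]
    simp_rw [fun b => sum_prod_pi_mul_pair (p := fun _ : Fin m => p) (fun _ => hp.2) hjk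
      (fun a => V a b) (fun a => if τ * q b < V a b then 1 else 0)]
    calc ∑ b, (∑ a, p a * V a b) * ∑ a, p a * (if τ * q b < V a b then 1 else 0)
        = ∑ b, ∑ a, p a * (q b * (if τ * q b < V a b then 1 else 0)) := by
          refine Finset.sum_congr rfl fun b _ => ?_
          rw [Finset.mul_sum]
          exact Finset.sum_congr rfl fun a _ => mul_left_comm _ _ _
      _ ≤ ∑ b, ∑ a, p a * (τ⁻¹ * V a b) := by
          refine Finset.sum_le_sum fun b _ => Finset.sum_le_sum fun a _ =>
            mul_le_mul_of_nonneg_left ?_ (hp.1 a)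
          split_ifs with h
          · rw [mul_one, inv_mul_eq_div, le_div_iff₀ hτ, mul_comm]; exact h.le
          · rw [mul_zero]; exact mul_nonneg (inv_nonneg.2 hτ.le) ((hV a).1 b)
      _ = τ⁻¹ := by
          rw [Finset.sum_comm]
          simp_rw [← Finset.mul_sum, (hV _).2, mul_one, ← Finset.sum_mul, hp.2, one_mul]
  calc _ ≤ ∑ f : Fin m → α, (∏ i, p (f i)) *
        ((∑ b, V (f j) b * (if V (f j) b ≤ τ * q b then 1 else 0))
          + ∑ k ∈ Finset.univ.erase j, ∑ b, V (f j) b * (if τ * q b < V (f k) b then 1 else 0)) := by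
        refine Finset.sum_le_sum fun f _ => mul_le_mul_of_nonneg_left ?_
          (Finset.prod_nonneg fun i _ => hp.1 _)
        rw [Finset.sum_comm (s := Finset.univ.erase j), ← Finset.sum_add_distrib]
        exact Finset.sum_le_sum fun b _ => hpt f b
    _ = (∑ a, p a * ∑ b, V a b * if V a b ≤ τ * q b then 1 else 0)
          + ∑ k ∈ Finset.univ.erase j, ∑ f : Fin m → α, (∏ i, p (f i)) *
            ∑ b, V (f j) b * (if τ * q b < V (f k) b then 1 else 0) := by
        simp_rw [mul_add, Finset.sum_add_distrib]
        congr 1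
        · exact sum_prod_pi_mul (p := fun _ : Fin m => p) (fun _ => hp.2) j
            fun a => ∑ b, V a b * if V a b ≤ τ * q b then 1 else 0
        · rw [Finset.sum_comm]
          simp_rw [Finset.mul_sum]
    _ ≤ _ := by
        gcongr
        refine (Finset.sum_le_sum hpair).trans_eq ?_
        rw [Finset.sum_const, Finset.card_erase_of_mem (Finset.mem_univ j), Finset.card_univ,
          Fintype.card_fin, nsmul_eq_mul, Nat.cast_pred hm]

open Classical in
theorem sum_prod_threshold_le (hW : ∀ x, IsDist (W x)) (hP : IsDist P)
    (hQ : ∀ y, 0 < outDist P W y) (n : ℕ) {a : ℝ} (ha : 0 < a) :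
    ∑ xs : Fin n → X, (∏ i, P (xs i)) * ∑ ys : Fin n → Y, (∏ i, W (xs i) (ys i)) *
        (if ∏ i, W (xs i) (ys i) ≤ Real.exp (n * mutInfo P W - a) * ∏ i, outDist P W (ys i)
          then 1 else 0)
      ≤ n * (∑ x, ∑ y, P x * W x y * Real.log (W x y / outDist P W y) ^ 2) / a ^ 2 := by
  set Q := outDist P W
  let p : X × Y → ℝ := fun z => P z.1 * W z.1 z.2
  let ξ : X × Y → ℝ := fun z => Real.log (W z.1 z.2 / Q z.2)
  have hp : IsDist p := by
    refine ⟨fun z => mul_nonneg (hP.1 _) ((hW _).1 _), ?_⟩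
    simp [p, Fintype.sum_prod_type, ← Finset.mul_sum, (hW _).2, hP.2]
  have hc := chebyshev_lower_tail (ι := Fin n) hp ξ ha
  have e1 : ∑ z, p z * ξ z = mutInfo P W := by
    simp [p, ξ, Fintype.sum_prod_type, mutInfo, Q]
  have e2 : ∑ z, p z * ξ z ^ 2
      = ∑ x, ∑ y, P x * W x y * Real.log (W x y / Q y) ^ 2 := by
    simp [p, ξ, Fintype.sum_prod_type]
  rw [e1, e2, Fintype.card_fin] at hc
  refine le_trans ?_ hc
  simp_rw [Finset.mul_sum]
  rw [← Fintype.sum_prod_type', ← (Equiv.arrowProdEquivProdArrow (Fin n) (fun _ => X)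
    fun _ => Y).sum_comp]
  refine Finset.sum_le_sum fun f _ => ?_
  simp only [Equiv.arrowProdEquivProdArrow, Equiv.coe_fn_mk, p, ξ]
  rw [← mul_assoc, ← Finset.prod_mul_distrib]
  have hp0 : 0 ≤ ∏ i, P (f i).1 * W (f i).1 (f i).2 := Finset.prod_nonneg fun i _ => hp.1 (f i)
  by_cases h : ∏ i, P (f i).1 * W (f i).1 (f i).2 = 0
  · simp [h]
  refine mul_le_mul_of_nonneg_left ?_ hp0
  have hWi : ∀ i, 0 < W (f i).1 (f i).2 := fun i => ((hW _).1 _).lt_of_ne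
    (right_ne_zero_of_mul (Finset.prod_ne_zero_iff.1 h i (Finset.mem_univ i))).symm
  have hQp : 0 < ∏ i, Q (f i).2 := Finset.prod_pos fun i _ => hQ _
  refine (ite_le_one_zero_of_imp fun h1 => ?_)
  rw [← Real.log_prod fun i _ => (div_pos (hWi i) (hQ _)).ne', Finset.prod_div_distrib,
    Real.log_le_iff_le_exp (div_pos (Finset.prod_pos fun i _ => hWi i) hQp), div_le_iff₀ hQp]
  exact h1

theorem achievability [DecidableEq Y] (hW : ∀ x, IsDist (W x)) (hP : IsDist P)
    (hQ : ∀ y, 0 < outDist P W y) (n : ℕ) {m : ℕ} (hm : 0 < m) {a : ℝ} (ha : 0 < a) :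
    ∃ ρ : (Fin m → Fin n → X) × ((Fin n → Y) → Fin m) → ℝ, IsDist ρ ∧
      codeOut W ρ = (fun ys => ∏ i, outDist P W (ys i)) ∧
      codeErr W ρ ≤ n * (∑ x, ∑ y, P x * W x y * Real.log (W x y / outDist P W y) ^ 2) / a ^ 2
        + (m - 1) * Real.exp (-(n * mutInfo P W - a)) := by
  have hm' : (0 : ℝ) < m := by exact_mod_cast hm
  let p : (Fin n → X) → ℝ := fun xs => ∏ i, P (xs i)
  let V : (Fin n → X) → (Fin n → Y) → ℝ := fun xs ys => ∏ i, W (xs i) (ys i)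
  have hp : IsDist p :=
    ⟨fun xs => Finset.prod_nonneg fun i _ => hP.1 _,
      sum_prod_pi_eq_one (p := fun _ => P) fun _ => hP.2⟩
  have hV : ∀ xs, IsDist (V xs) := fun xs =>
    ⟨fun ys => Finset.prod_nonneg fun i _ => (hW _).1 _,
      sum_prod_pi_eq_one (p := fun i => W (xs i)) fun i => (hW _).2⟩
  obtain ⟨dec, hdec⟩ := exists_threshold_decoder hV hp hm
    (Real.exp_pos (n * mutInfo P W - a))
  let ρ : (Fin m → Fin n → X) × ((Fin n → Y) → Fin m) → ℝ := fun c =>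
    (∏ j, p (c.1 j)) * if c.2 = dec c.1 then 1 else 0
  have hρ : ∀ G : (Fin m → Fin n → X) × ((Fin n → Y) → Fin m) → ℝ,
      ∑ c, ρ c * G c = ∑ f, (∏ j, p (f j)) * G (f, dec f) := by
    intro G
    simp [ρ, Fintype.sum_prod_type]
  have hp1 : ∑ f : Fin m → Fin n → X, ∏ j, p (f j) = 1 :=
    sum_prod_pi_eq_one (p := fun _ => p) fun _ => hp.2
  refine ⟨ρ, ⟨fun c => mul_nonneg (Finset.prod_nonneg fun j _ => hp.1 _)
    (by split_ifs <;> norm_num), ?_⟩, ?_, ?_⟩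
  · simpa [hp1] using hρ fun _ => 1
  · funext ys
    rw [codeOut, hρ, ← outDist_prod]
    simp_rw [Finset.mul_sum]
    rw [Finset.sum_comm]
    have : ∀ j : Fin m, ∑ f : Fin m → Fin n → X,
        (∏ k, p (f k)) * ((m : ℝ)⁻¹ * ∏ i, W (f j i) (ys i)) = (m : ℝ)⁻¹ * outDist p V ys := by
      intro j
      rw [sum_prod_pi_mul (p := fun _ : Fin m => p) (fun _ => hp.2) j
        fun xs => (m : ℝ)⁻¹ * ∏ i, W (xs i) (ys i), outDist, Finset.mul_sum]
      exact Finset.sum_congr rfl fun xs _ => mul_left_comm _ _ _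
    rw [Finset.sum_congr rfl fun j _ => this j]
    simp [hm'.ne', p, V]
  · rw [codeErr, hρ]
    simp_rw [Finset.mul_sum (s := Finset.univ (α := Fin m))]
    rw [Finset.sum_comm]
    have hj : ∀ j : Fin m, ∑ f : Fin m → Fin n → X, (∏ k, p (f k)) * ((m : ℝ)⁻¹ *
        ∑ ys : Fin n → Y, if dec f ys = j then 0 else ∏ i, W (f j i) (ys i))
        ≤ (m : ℝ)⁻¹ * (n * (∑ x, ∑ y, P x * W x y * Real.log (W x y / outDist P W y) ^ 2) / a ^ 2
        + (m - 1) * Real.exp (-(n * mutInfo P W - a))) := by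
      intro j
      simp_rw [mul_left_comm _ (m : ℝ)⁻¹, ← Finset.mul_sum]
      refine mul_le_mul_of_nonneg_left ((hdec j).trans ?_) (by positivity)
      rw [Real.exp_neg]
      gcongr
      have := sum_prod_threshold_le hW hP hQ n ha
      simp_rw [← outDist_prod] at this
      exact this
    refine (Finset.sum_le_sum fun j _ => hj j).trans_eq ?_
    simp [hm'.ne']

end Achievability

/-! ### The single-letter optimization -/

section CovertInfo

variable {X Y : Type*} [Fintype X] [Fintype Y] {W : X → Y → ℝ} {x0 : X}

/-- The largest mutual information over inputs whose output is within `d` of the output of `x0`. -/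
noncomputable def covertInfo (W : X → Y → ℝ) (x0 : X) (d : ℝ) : ℝ :=
  sSup {r : ℝ | ∃ P : X → ℝ, IsDist P ∧ relEnt (outDist P W) (W x0) ≤ d ∧ r = mutInfo P W}

theorem bddAbove_covertInfo (hW : ∀ x, IsDist (W x)) (x0 : X) (d : ℝ) :
    BddAbove {r : ℝ | ∃ P : X → ℝ, IsDist P ∧ relEnt (outDist P W) (W x0) ≤ d ∧
      r = mutInfo P W} := by
  refine ⟨∑ _x : X, ∑ _y : Y, 1, ?_⟩
  rintro r ⟨P, hP, -, rfl⟩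
  exact mutInfo_le_card hW hP

theorem mutInfo_le_covertInfo (hW : ∀ x, IsDist (W x)) {P : X → ℝ} (hP : IsDist P) {d : ℝ}
    (hd : relEnt (outDist P W) (W x0) ≤ d) : mutInfo P W ≤ covertInfo W x0 d :=
  le_csSup (bddAbove_covertInfo hW x0 d) ⟨P, hP, hd, rfl⟩

theorem exists_covert_input (hsupp : ∀ y, 0 < W x0 y) {d : ℝ}
    (hd : 0 ≤ d) :
    ∃ r : ℝ, ∃ P : X → ℝ, IsDist P ∧ relEnt (outDist P W) (W x0) ≤ d ∧ r = mutInfo P W := by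
  classical
  refine ⟨_, fun x => if x = x0 then 1 else 0, ⟨fun x => by positivity, by simp⟩, ?_, rfl⟩
  have : outDist (fun x => if x = x0 then 1 else 0) W = W x0 := by
    funext y; simp [outDist]
  rw [this, relEnt_self hsupp]
  exact hd

theorem covertInfo_nonneg (hW : ∀ x, IsDist (W x)) (x0 : X) (d : ℝ) : 0 ≤ covertInfo W x0 d := by
  refine Real.sSup_nonneg ?_
  rintro r ⟨P, hP, -, rfl⟩
  exact mutInfo_nonneg hW hP

theorem covertInfo_scale (hW : ∀ x, IsDist (W x)) (hsupp : ∀ y, 0 < W x0 y) {B : ℝ} (hB : 1 ≤ B)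
    (hB' : ∀ y, (W x0 y)⁻¹ ≤ B) {d d' r t : ℝ} (hd : 0 ≤ d) (hr0 : 0 ≤ r) (hr : r ≤ 1 / 16)
    (hdr : 4 * B ^ 2 * d ≤ r ^ 2) (ht0 : 0 < t) (ht1 : t < 1)
    (hd' : t ^ 2 * (1 + 32 * r) * d ≤ d') :
    t * covertInfo W x0 d ≤ covertInfo W x0 d' := by
  rw [← le_div_iff₀' ht0]
  refine csSup_le (exists_covert_input hsupp hd) ?_
  rintro _ ⟨P, hP, hPd, rfl⟩
  rw [le_div_iff₀' ht0]
  obtain ⟨P', hP', hout, hI⟩ := exists_mixture hW x0 hP ht0 ht1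
  refine hI.trans (mutInfo_le_covertInfo hW hP' (le_trans ?_ hd'))
  have hQ := isDist_outDist hW hP
  refine (relEnt_mixture_le hQ (hW x0) (isDist_outDist hW hP') hsupp ht0.le ht1.le hout hr
    (abs_div_sub_one_le hQ (hW x0) hsupp hB hB' hr0 hPd hdr)).trans ?_
  gcongr

theorem eventually_mul_div_le (c : ℝ) {b : ℝ} (hb : 0 < b) : ∀ᶠ n : ℕ in atTop, c / n ≤ b :=
  (tendsto_const_div_atTop_nhds_zero_nat c).eventually_le_const hb

/-- `√(n/δ)` times the optimal mutual information is nondecreasing up to a factor close to one. -/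
theorem eventually_scaled_covertInfo_le (hW : ∀ x, IsDist (W x)) (hsupp : ∀ y, 0 < W x0 y) {δ : ℝ}
    (hδ : 0 < δ) {θ : ℝ} (hθ0 : 0 < θ) (hθ1 : θ < 1) :
    ∀ᶠ n : ℕ in atTop, ∀ n' : ℕ, n ≤ n' →
      θ * (√(n / δ) * covertInfo W x0 (δ / n)) ≤ √(n' / δ) * covertInfo W x0 (δ / n') := by
  obtain ⟨B, hB, hB'⟩ := exists_inv_bound hsupp
  have hθ2 : θ ^ 2 < 1 := by nlinarith
  set r : ℝ := (1 - θ ^ 2) / 32 with hr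
  have hr0 : 0 < r := by rw [hr]; linarith
  have hr1 : r ≤ 1 / 16 := by rw [hr]; nlinarith [sq_nonneg θ]
  filter_upwards [eventually_mul_div_le (4 * B ^ 2 * δ) (pow_pos hr0 2), eventually_gt_atTop 0]
    with n hn hn0 n' hnn'
  have h0 : (0 : ℝ) < n := by exact_mod_cast hn0
  have h0' : (0 : ℝ) < n' := by exact_mod_cast hn0.trans_le hnn'
  have hle : (n : ℝ) ≤ n' := by exact_mod_cast hnn'
  have hq0 : 0 < √((n : ℝ) / n') := Real.sqrt_pos.2 (by positivity)
  have hq1 : √((n : ℝ) / n') ≤ 1 := Real.sqrt_le_one.2 ((div_le_one h0').2 hle)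
  have hs := covertInfo_scale (d := δ / n) (d' := δ / n') (t := θ * √(n / n')) hW hsupp hB hB'
    (by positivity) hr0.le hr1 (by rw [← mul_div_assoc]; exact hn) (by positivity) (by nlinarith) (by
      rw [mul_pow, Real.sq_sqrt (by positivity)]
      have e : θ ^ 2 * ((n : ℝ) / n') * (1 + 32 * r) * (δ / n)
          = θ ^ 2 * (1 + 32 * r) * (δ / n') := by field_simp
      rw [e]
      have : θ ^ 2 * (1 + 32 * r) ≤ 1 := by rw [hr]; nlinarith [sq_nonneg (1 - θ ^ 2)]
      exact mul_le_of_le_one_left (by positivity) this)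
  have e : √((n : ℝ) / δ) = √(n' / δ) * √(n / n') := by
    rw [← Real.sqrt_mul (by positivity)]; congr 1; field_simp
  calc _ = √(n' / δ) * (θ * √(n / n') * covertInfo W x0 (δ / n)) := by rw [e]; ring
    _ ≤ _ := by gcongr

end CovertInfo

/-! ### Bounds on the code size -/

section CodeSize

variable {X Y : Type*} [Fintype X] [Fintype Y] [DecidableEq Y] {W : X → Y → ℝ} {x0 : X} {δ ε : ℝ}

theorem Kmax_nonneg (W : X → Y → ℝ) (x0 : X) (δ ε : ℝ) (n : ℕ) : 0 ≤ Kmax W x0 δ ε n := by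
  refine Real.sSup_nonneg ?_
  rintro k ⟨m, -, -, -, -, -, -, rfl⟩
  exact Real.log_natCast_nonneg m

theorem log_le_of_code (hW : ∀ x, IsDist (W x)) (hsupp : ∀ y, 0 < W x0 y) (hε : ε < 1) {n : ℕ}
    (hn : 0 < n) {m : ℕ} (hm : 0 < m)
    {ρ : (Fin m → Fin n → X) × ((Fin n → Y) → Fin m) → ℝ} (hρ : IsDist ρ)
    (hδ : relEnt (codeOut W ρ) (fun ys : Fin n → Y => ∏ i, W x0 (ys i)) ≤ δ)
    (he : codeErr W ρ ≤ ε) :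
    Real.log m ≤ (n * covertInfo W x0 (δ / n) + Real.log 2) / (1 - ε) := by
  obtain ⟨P, hP, hPd, hI⟩ := converse hW hsupp hn hm hρ hδ he
  rw [le_div_iff₀' (by linarith)]
  have := mul_le_mul_of_nonneg_left (mutInfo_le_covertInfo hW hP hPd) (Nat.cast_nonneg (α := ℝ) n)
  linarith

theorem Kmax_le (hW : ∀ x, IsDist (W x)) (hsupp : ∀ y, 0 < W x0 y) (hε : ε < 1) {n : ℕ}
    (hn : 0 < n) :
    Kmax W x0 δ ε n ≤ (n * covertInfo W x0 (δ / n) + Real.log 2) / (1 - ε) := by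
  refine Real.sSup_le ?_ ?_
  · rintro k ⟨m, hm, ρ, h0, h1, hd, he, rfl⟩
    exact log_le_of_code hW hsupp hε hn hm ⟨h0, h1⟩ hd he
  · have := covertInfo_nonneg hW x0 (δ / n)
    have : 0 ≤ Real.log 2 := Real.log_nonneg one_le_two
    have : 0 ≤ 1 - ε := by linarith
    positivity

theorem log_le_Kmax (hW : ∀ x, IsDist (W x)) (hsupp : ∀ y, 0 < W x0 y) (hε : ε < 1) {n : ℕ}
    (hn : 0 < n) {m : ℕ} (hm : 0 < m)
    {ρ : (Fin m → Fin n → X) × ((Fin n → Y) → Fin m) → ℝ} (hρ : IsDist ρ)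
    (hδ : relEnt (codeOut W ρ) (fun ys : Fin n → Y => ∏ i, W x0 (ys i)) ≤ δ)
    (he : codeErr W ρ ≤ ε) : Real.log m ≤ Kmax W x0 δ ε n := by
  refine le_csSup ⟨(n * covertInfo W x0 (δ / n) + Real.log 2) / (1 - ε), ?_⟩
    ⟨m, hm, ρ, hρ.1, hρ.2, hδ, he, rfl⟩
  rintro k ⟨m, hm, ρ, h0, h1, hd, he, rfl⟩
  exact log_le_of_code hW hsupp hε hn hm ⟨h0, h1⟩ hd he

theorem tendsto_sqrt_natCast_mul_atTop (hδ : 0 < δ) :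
    Tendsto (fun n : ℕ => √((n : ℝ) * δ)) atTop atTop :=
  Real.tendsto_sqrt_atTop.comp (tendsto_natCast_atTop_atTop.atTop_mul_const hδ)

theorem sqrt_mul_sqrt_div (hδ : 0 < δ) (n : ℕ) : √((n : ℝ) * δ) * √(n / δ) = n := by
  rw [← Real.sqrt_mul (by positivity)]
  have : (n : ℝ) * δ * (n / δ) = n ^ 2 := by field_simp
  rw [this, Real.sqrt_sq (Nat.cast_nonneg n)]

/-- Size of the best code when the expected information density `A` is large. -/
theorem mul_le_log_of_achievability (hW : ∀ x, IsDist (W x)) {P : X → ℝ} (hP : IsDist P) {B : ℝ}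
    (hB : 1 ≤ B) (hQ : ∀ y, 0 < outDist P W y) (hQB : ∀ y, (outDist P W y)⁻¹ ≤ B) {κ : ℝ}
    (hκ0 : 0 < κ) (hκ1 : κ < 1) (hε : 0 < ε) {n : ℕ}
    (hA : (4 * B / κ ^ 2 + 1 / (κ * (1 - κ))) / ε ≤ n * mutInfo P W) (hA0 : 0 < n * mutInfo P W) :
    ∃ m : ℕ, 0 < m ∧ (1 - κ) ^ 2 * (n * mutInfo P W) ≤ Real.log m ∧
      ∃ ρ : (Fin m → Fin n → X) × ((Fin n → Y) → Fin m) → ℝ, IsDist ρ ∧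
        codeOut W ρ = (fun ys => ∏ i, outDist P W (ys i)) ∧ codeErr W ρ ≤ ε := by
  set A := n * mutInfo P W with hAdef
  have hκ' : 0 < 1 - κ := by linarith
  have hm : 0 < ⌈Real.exp ((1 - κ) ^ 2 * A)⌉₊ := Nat.ceil_pos.2 (Real.exp_pos _)
  obtain ⟨ρ, hρ, hout, herr⟩ := achievability hW hP hQ n hm (mul_pos hκ0 hA0)
  refine ⟨_, hm, ?_, ρ, hρ, hout, herr.trans ?_⟩
  · rw [Real.le_log_iff_exp_le (by exact_mod_cast hm)]
    exact Nat.le_ceil _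
  have h1 : n * (∑ x, ∑ y, P x * W x y * Real.log (W x y / outDist P W y) ^ 2) / (κ * A) ^ 2
      ≤ 4 * B / κ ^ 2 / A := by
    have := mul_le_mul_of_nonneg_left (sum_mul_log_sq_le hW hP hB hQ hQB)
      (Nat.cast_nonneg (α := ℝ) n)
    have e : 4 * B / κ ^ 2 / A = 4 * B * A / (κ * A) ^ 2 := by field_simp
    rw [e]
    refine div_le_div_of_nonneg_right ?_ (sq_nonneg _)
    rw [hAdef]; linarith
  have h2 : ((⌈Real.exp ((1 - κ) ^ 2 * A)⌉₊ : ℝ) - 1) * Real.exp (-(A - κ * A))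
      ≤ 1 / (κ * (1 - κ)) / A := by
    have hc := Nat.ceil_lt_add_one (Real.exp_pos ((1 - κ) ^ 2 * A)).le
    calc _ ≤ Real.exp ((1 - κ) ^ 2 * A) * Real.exp (-(A - κ * A)) := by
          gcongr; linarith
      _ = (Real.exp (κ * (1 - κ) * A))⁻¹ := by
          rw [← Real.exp_add, ← Real.exp_neg]; congr 1; ring
      _ ≤ (κ * (1 - κ) * A)⁻¹ := by
          gcongr
          linarith [Real.add_one_le_exp (κ * (1 - κ) * A)]
      _ = _ := by field_simp
  calc _ ≤ 4 * B / κ ^ 2 / A + 1 / (κ * (1 - κ)) / A := add_le_add h1 h2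
    _ = (4 * B / κ ^ 2 + 1 / (κ * (1 - κ))) / A := by rw [add_div]
    _ ≤ ε := by
        rw [div_le_iff₀ hA0]
        rwa [div_le_iff₀' hε] at hA

theorem eventually_le_Kmax (hW : ∀ x, IsDist (W x)) (hsupp : ∀ y, 0 < W x0 y) (hδ : 0 < δ)
    (hε0 : 0 < ε) (hε1 : ε < 1) {θ c : ℝ} (hθ0 : 0 < θ) (hθ1 : θ < 1) (hc : 0 < c) :
    ∀ᶠ n : ℕ in atTop, c ≤ √(n / δ) * covertInfo W x0 (δ / n) →
      θ * (n * covertInfo W x0 (δ / n)) ≤ Kmax W x0 δ ε n := by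
  obtain ⟨B, hB, hB'⟩ := exists_inv_bound hsupp
  set κ := (1 - θ) / 3 with hκ
  have hκ0 : 0 < κ := by rw [hκ]; linarith
  have hκ1 : κ < 1 := by rw [hκ]; linarith
  have hκ' : 0 < 1 - κ := by linarith
  set C := (4 * (2 * B) / κ ^ 2 + 1 / (κ * (1 - κ))) / ε
  filter_upwards [eventually_mul_div_le (4 * B ^ 2 * δ) (by norm_num : (0 : ℝ) < (1 / 2) ^ 2),
    eventually_gt_atTop 0,
    (tendsto_sqrt_natCast_mul_atTop hδ).eventually_ge_atTop (C / ((1 - κ) * c))]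
    with n hnB hn hnC hca
  have hn' : (0 : ℝ) < n := by exact_mod_cast hn
  set S := covertInfo W x0 (δ / n) with hS
  have hsq : 0 < √((n : ℝ) * δ) := Real.sqrt_pos.2 (by positivity)
  have hnS : √((n : ℝ) * δ) * c ≤ n * S := by
    calc _ ≤ √((n : ℝ) * δ) * (√(n / δ) * S) := by gcongr
      _ = n * S := by rw [← mul_assoc, sqrt_mul_sqrt_div hδ]
  have hS0 : 0 < S := pos_of_mul_pos_right ((mul_pos hsq hc).trans_le hnS) hn'.le
  obtain ⟨_, ⟨P, hP, hPd, rfl⟩, hPS⟩ :=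
    exists_lt_of_lt_csSup (exists_covert_input hsupp (d := δ / n) (by positivity))
      (show (1 - κ) * S < covertInfo W x0 (δ / n) by rw [← hS]; nlinarith)
  have hA : (1 - κ) * (n * S) ≤ n * mutInfo P W := by
    calc (1 - κ) * (n * S) = n * ((1 - κ) * S) := by ring
      _ ≤ _ := by gcongr
  have hA0 : 0 < n * mutInfo P W := lt_of_lt_of_le (by positivity) hA
  have hCA : C ≤ n * mutInfo P W := by
    rw [div_le_iff₀ (by positivity)] at hnC
    calc C ≤ √((n : ℝ) * δ) * ((1 - κ) * c) := hnC
      _ = (1 - κ) * (√((n : ℝ) * δ) * c) := by ring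
      _ ≤ (1 - κ) * (n * S) := by gcongr
      _ ≤ _ := hA
  have hQd := isDist_outDist hW hP
  have hQhalf : ∀ y, W x0 y / 2 ≤ outDist P W y := by
    intro y
    have := abs_div_sub_one_le hQd (hW x0) hsupp hB hB' (r := 1 / 2) (by norm_num) hPd
      (by rw [← mul_div_assoc]; exact hnB) y
    have := (abs_le.1 this).1
    have h2 : 1 / 2 ≤ outDist P W y / W x0 y := by linarith
    rw [le_div_iff₀ (hsupp y)] at h2
    linarith
  have hQ : ∀ y, 0 < outDist P W y := fun y => (half_pos (hsupp y)).trans_le (hQhalf y)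
  have hQB : ∀ y, (outDist P W y)⁻¹ ≤ 2 * B := by
    intro y
    calc (outDist P W y)⁻¹ ≤ (W x0 y / 2)⁻¹ := inv_anti₀ (half_pos (hsupp y)) (hQhalf y)
      _ = 2 * (W x0 y)⁻¹ := by rw [inv_div]; rfl
      _ ≤ 2 * B := by gcongr; exact hB' y
  obtain ⟨m, hm, hlog, ρ, hρ, hout, herr⟩ :=
    mul_le_log_of_achievability hW hP (by linarith : 1 ≤ 2 * B) hQ hQB hκ0 hκ1 hε0 hCA hA0
  have hK : Real.log m ≤ Kmax W x0 δ ε n := by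
    refine log_le_Kmax hW hsupp hε1 hn hm hρ ?_ herr
    rw [hout, relEnt_prod hQd hQ hsupp]
    rwa [le_div_iff₀' hn'] at hPd
  have hθκ : θ ≤ (1 - κ) ^ 2 * (1 - κ) := by
    have e : θ = 1 - 3 * κ := by rw [hκ]; ring
    nlinarith [mul_nonneg (sq_nonneg κ) (by linarith : 0 ≤ 3 - κ)]
  calc θ * (n * S) ≤ (1 - κ) ^ 2 * (1 - κ) * (n * S) := by gcongr
    _ = (1 - κ) ^ 2 * ((1 - κ) * (n * S)) := by ring
    _ ≤ (1 - κ) ^ 2 * (n * mutInfo P W) := by gcongr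
    _ ≤ _ := hlog.trans hK

end CodeSize

/-! ### Limits -/

theorem exists_tendsto_of_almost_monotone {a : ℕ → ℝ} (ha : ∀ n, 0 ≤ a n)
    (h : ∀ θ : ℝ, 0 < θ → θ < 1 → ∀ᶠ n : ℕ in atTop, ∀ n', n ≤ n' → θ * a n ≤ a n') :
    Tendsto (fun n => (a n : EReal)) atTop (nhds (liminf (fun n => (a n : EReal)) atTop)) := by
  refine tendsto_of_le_liminf_of_limsup_le le_rfl (EReal.le_of_forall_lt_iff_le.1 fun c hc => ?_)
  by_contra! hlt
  obtain ⟨c', hcc', hc'⟩ := EReal.lt_iff_exists_real_btwn.1 hlt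
  have hcc' : c < c' := by exact_mod_cast hcc'
  have h0 : (0 : EReal) ≤ liminf (fun n => (a n : EReal)) atTop :=
    le_liminf_of_le (by isBoundedDefault) (Eventually.of_forall fun n => by exact_mod_cast ha n)
  have hc0 : 0 < c := by exact_mod_cast h0.trans_lt hc
  have hc0' : 0 < c' := hc0.trans hcc'
  obtain ⟨n, hn, hn'⟩ := ((frequently_lt_of_lt_limsup (by isBoundedDefault) hc').and_eventually
    (h (c / c') (div_pos hc0 hc0') ((div_lt_one hc0').2 hcc'))).exists
  have hn : c' < a n := by exact_mod_cast hn
  refine hc.not_ge (le_liminf_of_le (by isBoundedDefault) ?_)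
  filter_upwards [eventually_ge_atTop n] with n' hnn'
  have := hn' n' hnn'
  have h2 : c / c' * c' ≤ c / c' * a n := by gcongr
  rw [div_mul_cancel₀ _ hc0'.ne'] at h2
  exact_mod_cast h2.trans this

theorem le_liminf_Kmax {X Y : Type*} [Fintype X] [Fintype Y] [DecidableEq Y]
    {W : X → Y → ℝ} {x0 : X} (hW : ∀ x, IsDist (W x)) (hsupp : ∀ y, 0 < W x0 y)
    {δ ε : ℝ} (hδ : 0 < δ) (hε0 : 0 < ε) (hε1 : ε < 1) {ℓ : EReal}
    (hℓ : Tendsto (fun n : ℕ => ((√(n / δ) * covertInfo W x0 (δ / n) : ℝ) : EReal)) atTop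
      (nhds ℓ)) :
    ℓ ≤ liminf (fun n : ℕ => ((Kmax W x0 δ ε n / √(n * δ) : ℝ) : EReal)) atTop := by
  refine EReal.ge_of_forall_gt_iff_ge.1 fun c hc => ?_
  refine le_liminf_of_le (by isBoundedDefault) ?_
  rcases le_or_gt c 0 with hc0 | hc0
  · refine Eventually.of_forall fun n => ?_
    exact_mod_cast hc0.trans (div_nonneg (Kmax_nonneg W x0 δ ε n) (Real.sqrt_nonneg _))
  obtain ⟨c', hcc', hc'⟩ := EReal.lt_iff_exists_real_btwn.1 hc
  have hcc' : c < c' := by exact_mod_cast hcc'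
  have hc0' : 0 < c' := hc0.trans hcc'
  filter_upwards [hℓ.eventually_const_lt hc', eventually_gt_atTop 0,
    eventually_le_Kmax hW hsupp hδ hε0 hε1 (div_pos hc0 hc0') ((div_lt_one hc0').2 hcc') hc0']
    with n hn hn0 hK
  have hn : c' < √(n / δ) * covertInfo W x0 (δ / n) := by exact_mod_cast hn
  have hn0' : (0 : ℝ) < n := by exact_mod_cast hn0
  have hsq : 0 < √((n : ℝ) * δ) := Real.sqrt_pos.2 (by positivity)
  suffices c ≤ Kmax W x0 δ ε n / √(n * δ) by exact_mod_cast this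
  rw [le_div_iff₀ hsq]
  refine le_trans ?_ (hK hn.le)
  calc c * √(n * δ) = c / c' * (√(n * δ) * c') := by field_simp
    _ ≤ c / c' * (√(n * δ) * (√(n / δ) * covertInfo W x0 (δ / n))) := by gcongr
    _ = _ := by rw [← mul_assoc (√(n * δ)), sqrt_mul_sqrt_div hδ]

theorem eventually_liminf_Kmax_le {X Y : Type*} [Fintype X] [Fintype Y] [DecidableEq Y]
    {W : X → Y → ℝ} {x0 : X} (hW : ∀ x, IsDist (W x)) (hsupp : ∀ y, 0 < W x0 y)
    {δ : ℝ} (hδ : 0 < δ) {ℓ : EReal}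
    (hℓ : Tendsto (fun n : ℕ => ((√(n / δ) * covertInfo W x0 (δ / n) : ℝ) : EReal)) atTop
      (nhds ℓ)) {c : ℝ} (hc : ℓ < c) :
    ∀ᶠ ε in nhdsWithin 0 (Set.Ioi 0),
      liminf (fun n : ℕ => ((Kmax W x0 δ ε n / √(n * δ) : ℝ) : EReal)) atTop ≤ c := by
  obtain ⟨b, hb, hbc⟩ := EReal.lt_iff_exists_real_btwn.1 hc
  have hbc : b < c := by exact_mod_cast hbc
  obtain ⟨b', hbb', hbc'⟩ := exists_between hbc
  have hlim : Tendsto (fun ε : ℝ => b' / (1 - ε)) (nhds 0) (nhds b') := by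
    have : ContinuousAt (fun ε : ℝ => b' / (1 - ε)) 0 :=
      continuousAt_const.div (continuousAt_const.sub continuousAt_id) (by norm_num)
    simpa [ContinuousAt] using this
  filter_upwards [nhdsWithin_le_nhds (hlim.eventually_lt_const hbc'),
    nhdsWithin_le_nhds (eventually_lt_nhds one_pos)] with ε hε hε1
  refine liminf_le_of_frequently_le' (Eventually.frequently ?_)
  have h2 : Tendsto (fun n : ℕ => Real.log 2 / √(n * δ)) atTop (nhds 0) :=
    tendsto_const_nhds.div_atTop (tendsto_sqrt_natCast_mul_atTop hδ)
  filter_upwards [hℓ.eventually_lt_const hb, eventually_gt_atTop 0,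
    h2.eventually_lt_const (sub_pos.2 hbb')] with n hn hn0 hlog
  have hn : √(n / δ) * covertInfo W x0 (δ / n) < b := by exact_mod_cast hn
  have hn0' : (0 : ℝ) < n := by exact_mod_cast hn0
  have hsq : 0 < √((n : ℝ) * δ) := Real.sqrt_pos.2 (by positivity)
  suffices Kmax W x0 δ ε n / √(n * δ) ≤ c by exact_mod_cast this
  have h1ε : 0 < 1 - ε := by linarith
  calc Kmax W x0 δ ε n / √(n * δ)
      ≤ (n * covertInfo W x0 (δ / n) + Real.log 2) / (1 - ε) / √(n * δ) := by
        gcongr; exact Kmax_le hW hsupp hε1 hn0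
    _ = (√(n / δ) * covertInfo W x0 (δ / n) + Real.log 2 / √(n * δ)) / (1 - ε) := by
        rw [← sqrt_mul_sqrt_div hδ n]
        have : √((n : ℝ) * δ) * √(n / δ) / δ = n / δ := by rw [sqrt_mul_sqrt_div hδ]
        rw [sqrt_mul_sqrt_div hδ]
        nth_rewrite 1 [← sqrt_mul_sqrt_div hδ n]
        field_simp
    _ ≤ b' / (1 - ε) := by gcongr; linarith
    _ ≤ c := hε.le

theorem statement3 {X Y : Type*} [Fintype X] [Fintype Y] [DecidableEq Y]
    (W : X → Y → ℝ) (x0 : X) (hW : ∀ x, IsDist (W x)) (hsupp : ∀ y, 0 < W x0 y)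
    (δ : ℝ) (hδ : 0 < δ) (L : EReal) (hL : IsL W x0 δ L) :
    Tendsto (fun n : ℕ =>
        ((Real.sqrt (n / δ) *
          sSup {r : ℝ | ∃ P : X → ℝ, IsDist P ∧ relEnt (outDist P W) (W x0) ≤ δ / n ∧
            r = mutInfo P W} : ℝ) : EReal))
      atTop (nhds L) := by
  change Tendsto (fun n : ℕ => ((√(n / δ) * covertInfo W x0 (δ / n) : ℝ) : EReal)) atTop (nhds L)
  have hlim := exists_tendsto_of_almost_monotone
    (fun n : ℕ => mul_nonneg (Real.sqrt_nonneg (n / δ)) (covertInfo_nonneg hW x0 (δ / n)))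
    fun θ hθ0 hθ1 => eventually_scaled_covertInfo_le hW hsupp hδ hθ0 hθ1
  convert hlim using 2
  refine le_antisymm (EReal.le_of_forall_lt_iff_le.1 fun c hc => ?_) ?_
  · exact le_of_tendsto hL (eventually_liminf_Kmax_le hW hsupp hδ hlim hc)
  · refine ge_of_tendsto hL ?_
    filter_upwards [self_mem_nhdsWithin, nhdsWithin_le_nhds (eventually_lt_nhds one_pos)]
      with ε hε0 hε1
    exact le_liminf_Kmax hW hsupp hδ hε0 hε1 hlim
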